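/- arXiv:2507.11031 — 3 statements merged into one kernel-verified Lean document; each statement's English description precedes it below -/
import Mathlib

section
/- Let Ω be a finite partially ordered set and μ a distribution on Ω with μ(σ) > 0 for all σ ∈ Ω. (1) For any two distributions π and π' on Ω, if σ ↦ π(σ)/μ(σ) is an increasing function and π ≼_sd π', then d_TV(π, μ) ≤ d_TV(π', μ). (2) Consequently, for two Markov chains P, Q ∈ MC_μ with P ≼_mc Q and any distribution π₀ on Ω such that σ ↦ π₀(σ)/μ(σ) is increasing, d_TV(π₀P, μ) ≤ d_TV(π₀Q, μ). -/
open Finset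

/-- A probability distribution on a finite type. -/
def IsDist {Ω : Type*} [Fintype Ω] (μ : Ω → ℝ) : Prop :=
  (∀ σ, 0 ≤ μ σ) ∧ ∑ σ, μ σ = 1

/-- An increasing (nonnegative) function on a partially ordered set. -/
def Incr {Ω : Type*} [Preorder Ω] (f : Ω → ℝ) : Prop :=
  (∀ x, 0 ≤ f x) ∧ ∀ x y, x ≤ y → f x ≤ f y

/-- Stochastic dominance: `a ≼_sd b` iff `∑ a·f ≤ ∑ b·f` for every increasing
nonnegative `f`. -/
def sd {Ω : Type*} [Fintype Ω] [Preorder Ω] (a b : Ω → ℝ) : Prop :=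
  ∀ f : Ω → ℝ, Incr f → ∑ x, a x * f x ≤ ∑ x, b x * f x

/-- A Markov chain (stochastic matrix) on a finite set. -/
def IsMC {Ω : Type*} [Fintype Ω] (P : Ω → Ω → ℝ) : Prop :=
  (∀ σ τ, 0 ≤ P σ τ) ∧ ∀ σ, ∑ τ, P σ τ = 1

/-- Reversibility of `P` with respect to `μ`. -/
def Reversible {Ω : Type*} (μ : Ω → ℝ) (P : Ω → Ω → ℝ) : Prop :=
  ∀ σ τ, μ σ * P σ τ = μ τ * P τ σ

/-- A Markov chain acting on a function (column vector): `(Pf)(σ) = ∑_τ P(σ,τ) f(τ)`. -/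
noncomputable def actF {Ω : Type*} [Fintype Ω] (P : Ω → Ω → ℝ) (f : Ω → ℝ) : Ω → ℝ :=
  fun σ => ∑ τ, P σ τ * f τ

/-- A Markov chain acting on a distribution (row vector): `(νP)(τ) = ∑_σ ν(σ) P(σ,τ)`. -/
noncomputable def actD {Ω : Type*} [Fintype Ω] (ν : Ω → ℝ) (P : Ω → Ω → ℝ) : Ω → ℝ :=
  fun τ => ∑ σ, ν σ * P σ τ

/-- `P` is stochastically monotone: `Pf` is increasing for every increasing `f`. -/
def StochMono {Ω : Type*} [Fintype Ω] [Preorder Ω] (P : Ω → Ω → ℝ) : Prop :=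
  ∀ f : Ω → ℝ, Incr f → Incr (actF P f)

/-- Membership in the family `MC_μ` of Markov chains that are reversible with respect
to `μ` and stochastically monotone. -/
def MemMC {Ω : Type*} [Fintype Ω] [Preorder Ω] (μ : Ω → ℝ) (P : Ω → Ω → ℝ) : Prop :=
  IsMC P ∧ Reversible μ P ∧ StochMono P

/-- The comparison inequality relation `P ≼_mc Q`: for every distribution `ν` with
`ν/μ` increasing, `νP ≼_sd νQ`. -/
def mcLE {Ω : Type*} [Fintype Ω] [Preorder Ω] (μ : Ω → ℝ) (P Q : Ω → Ω → ℝ) : Prop :=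
  ∀ ν : Ω → ℝ, IsDist ν → Incr (fun σ => ν σ / μ σ) → sd (actD ν P) (actD ν Q)

/-- Total variation distance `(1/2) ∑ |a σ - b σ|`. -/
noncomputable def dTV {Ω : Type*} [Fintype Ω] (a b : Ω → ℝ) : ℝ :=
  (∑ σ, |a σ - b σ|) / 2

theorem IsDist.actD {Ω : Type*} [Fintype Ω] {ν : Ω → ℝ} {P : Ω → Ω → ℝ}
    (hν : IsDist ν) (hP : IsMC P) : IsDist (actD ν P) := by
  refine ⟨fun τ => Finset.sum_nonneg fun σ _ => mul_nonneg (hν.1 σ) (hP.1 σ τ), ?_⟩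
  simp only [_root_.actD]
  rw [Finset.sum_comm]
  simp only [← Finset.mul_sum, hP.2, mul_one, hν.2]

/-- For a reversible chain, the density of `νP` is the image under `P` of the density of `ν`. -/
theorem Reversible.actD_div {Ω : Type*} [Fintype Ω] {μ : Ω → ℝ} {P : Ω → Ω → ℝ}
    (hP : Reversible μ P) (hpos : ∀ σ, 0 < μ σ) (ν : Ω → ℝ) :
    (fun τ => actD ν P τ / μ τ) = actF P (fun σ => ν σ / μ σ) := by
  funext τ
  simp only [actD, actF, Finset.sum_div]
  refine Finset.sum_congr rfl fun σ _ => ?_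
  have hσ := (hpos σ).ne'
  have hτ := (hpos τ).ne'
  field_simp
  linear_combination ν σ * hP σ τ

theorem dTV_le_of_sd {Ω : Type*} [Fintype Ω] [Preorder Ω] {μ π π' : Ω → ℝ}
    (hpos : ∀ σ, 0 < μ σ) (hπ : IsDist π) (hπ' : IsDist π')
    (hincr : Incr (fun σ => π σ / μ σ)) (hsd : sd π π') : dTV π μ ≤ dTV π' μ := by
  classical
  let f : Ω → ℝ := fun σ => if μ σ ≤ π σ then 1 else 0
  have hf : Incr f := by
    refine ⟨fun x => by simp only [f]; split_ifs <;> norm_num, fun x y hxy => ?_⟩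
    by_cases hx : μ x ≤ π x
    · have hy : μ y ≤ π y :=
        (one_le_div (hpos y)).1 (((one_le_div (hpos x)).2 hx).trans (hincr.2 x y hxy))
      simp [f, hx, hy]
    · simp only [f, hx, if_false]
      split_ifs <;> norm_num
  have habs : ∀ σ, |π σ - μ σ| = (2 * f σ - 1) * (π σ - μ σ) := by
    intro σ
    by_cases h : μ σ ≤ π σ
    · rw [abs_of_nonneg (sub_nonneg.2 h)]
      simp only [f, h, if_true]
      ring
    · rw [abs_of_neg (sub_neg.2 (not_le.1 h))]
      simp only [f, h, if_false]
      ring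
  have hle : ∀ σ, (2 * f σ - 1) * (π' σ - μ σ) ≤ |π' σ - μ σ| := by
    intro σ
    by_cases h : μ σ ≤ π σ
    · simp only [f, h, if_true]
      linarith [le_abs_self (π' σ - μ σ)]
    · simp only [f, h, if_false]
      linarith [neg_le_abs (π' σ - μ σ)]
  have hexpand : ∀ ρ : Ω → ℝ, ∑ σ, (2 * f σ - 1) * (ρ σ - μ σ) =
      2 * ∑ σ, ρ σ * f σ - ∑ σ, ρ σ - ∑ σ, (2 * f σ - 1) * μ σ := by
    intro ρ
    rw [Finset.mul_sum, ← Finset.sum_sub_distrib, ← Finset.sum_sub_distrib]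
    exact Finset.sum_congr rfl fun σ _ => by ring
  have hsum : ∑ σ, |π σ - μ σ| ≤ ∑ σ, |π' σ - μ σ| :=
    calc ∑ σ, |π σ - μ σ| = ∑ σ, (2 * f σ - 1) * (π σ - μ σ) :=
          Finset.sum_congr rfl fun σ _ => habs σ
      _ ≤ ∑ σ, (2 * f σ - 1) * (π' σ - μ σ) := by
          rw [hexpand, hexpand, hπ.2, hπ'.2]
          linarith [hsd f hf]
      _ ≤ ∑ σ, |π' σ - μ σ| := Finset.sum_le_sum fun σ _ => hle σ
  simp only [dTV]
  linarith

/-- **Stochastic dominance controls total variation distance for increasing densities**: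
(1) if `π/μ` is increasing and `π ≼_sd π'`, then `d_TV(π, μ) ≤ d_TV(π', μ)`;
(2) consequently, if `P ≼_mc Q` in `MC_μ` and `π₀/μ` is increasing, then
`d_TV(π₀P, μ) ≤ d_TV(π₀Q, μ)`. -/
theorem dTV_le_of_sd_and_mcLE {Ω : Type*} [Fintype Ω] [PartialOrder Ω]
    (μ : Ω → ℝ) (hμ : IsDist μ) (hpos : ∀ σ, 0 < μ σ) :
    (∀ π π' : Ω → ℝ, IsDist π → IsDist π' → Incr (fun σ => π σ / μ σ) → sd π π' →
        dTV π μ ≤ dTV π' μ) ∧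
      (∀ P Q : Ω → Ω → ℝ, MemMC μ P → MemMC μ Q → mcLE μ P Q →
        ∀ π₀ : Ω → ℝ, IsDist π₀ → Incr (fun σ => π₀ σ / μ σ) →
          dTV (actD π₀ P) μ ≤ dTV (actD π₀ Q) μ) := by
  refine ⟨fun π π' hπ hπ' hincr hsd => dTV_le_of_sd hpos hπ hπ' hincr hsd,
    fun P Q hP hQ hPQ π₀ hπ₀ hincr => ?_⟩
  refine dTV_le_of_sd hpos (hπ₀.actD hP.1) (hπ₀.actD hQ.1) ?_ (hPQ π₀ hπ₀ hincr)
  rw [hP.2.1.actD_div hpos π₀]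
  exact hP.2.2 _ hincr
end

section
/- Let Ω be a finite partially ordered set, μ a distribution on Ω with μ(σ) > 0 for all σ ∈ Ω, and let P, Q be Markov chains on Ω that are reversible with respect to μ. Then the following are equivalent: (i) for every distribution ν on Ω such that σ ↦ ν(σ)/μ(σ) is increasing, νP ≼_sd νQ; (ii) for all increasing functions f, g : Ω → ℝ≥0, ⟨Pg, f⟩_μ ≤ ⟨Qg, f⟩_μ, where ⟨h, ℓ⟩_μ = ∑_{σ∈Ω} h(σ)ℓ(σ)μ(σ). -/
open Finset

/-- For a chain reversible with respect to `μ`, the density of `νP` is `P` applied to the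
density of `ν`. -/
lemma Reversible.sum_actD_mul {Ω : Type*} [Fintype Ω] {μ : Ω → ℝ} {P : Ω → Ω → ℝ}
    (hP : Reversible μ P) (f g : Ω → ℝ) :
    ∑ τ, actD (fun σ => g σ * μ σ) P τ * f τ = ∑ τ, actF P g τ * f τ * μ τ := by
  refine Finset.sum_congr rfl fun τ _ => ?_
  have h : actD (fun σ => g σ * μ σ) P τ = actF P g τ * μ τ := by
    simp only [actD, actF, Finset.sum_mul]
    refine Finset.sum_congr rfl fun σ _ => ?_
    linear_combination g σ * hP σ τ
  rw [h]
  ring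

/-- **Equivalence of the two definitions of the comparison inequality relation** for
chains reversible with respect to `μ`: (i) `νP ≼_sd νQ` for every distribution `ν`
with `ν/μ` increasing, iff (ii) `⟨Pg, f⟩_μ ≤ ⟨Qg, f⟩_μ` for all increasing
nonnegative `f, g`, where `⟨h, ℓ⟩_μ = ∑_σ h(σ) ℓ(σ) μ(σ)`. -/
theorem mcLE_iff_inner_product {Ω : Type*} [Fintype Ω] [PartialOrder Ω]
    (μ : Ω → ℝ) (hμ : IsDist μ) (hpos : ∀ σ, 0 < μ σ)
    (P Q : Ω → Ω → ℝ) (hPmc : IsMC P) (hQmc : IsMC Q)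
    (hPrev : Reversible μ P) (hQrev : Reversible μ Q) :
    (∀ ν : Ω → ℝ, IsDist ν → Incr (fun σ => ν σ / μ σ) → sd (actD ν P) (actD ν Q)) ↔
      (∀ f g : Ω → ℝ, Incr f → Incr g →
        ∑ σ, actF P g σ * f σ * μ σ ≤ ∑ σ, actF Q g σ * f σ * μ σ) := by
  constructor
  · intro h f g hf hg
    have hgμ : ∀ σ, 0 ≤ g σ * μ σ := fun σ => mul_nonneg (hg.1 σ) (hpos σ).le
    set c := ∑ σ, g σ * μ σ with hc
    rcases (Finset.sum_nonneg fun σ _ => hgμ σ : 0 ≤ c).eq_or_lt with h0 | h0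
    · have hg0 : ∀ σ, g σ = 0 := fun σ =>
        (mul_eq_zero.1 ((Finset.sum_eq_zero_iff_of_nonneg fun σ _ => hgμ σ).1 h0.symm σ
          (Finset.mem_univ σ))).resolve_right (hpos σ).ne'
      simp [actF, hg0]
    · have hν : IsDist fun σ => g σ / c * μ σ := by
        refine ⟨fun σ => mul_nonneg (div_nonneg (hg.1 σ) h0.le) (hpos σ).le, ?_⟩
        simp only [div_mul_eq_mul_div]
        rw [← Finset.sum_div, ← hc, div_self h0.ne']
      have hi : Incr fun σ => g σ / c * μ σ / μ σ := by
        simp only [mul_div_cancel_right₀ _ (hpos _).ne']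
        exact ⟨fun σ => div_nonneg (hg.1 σ) h0.le,
          fun x y hxy => div_le_div_of_nonneg_right (hg.2 x y hxy) h0.le⟩
      have hsd := h _ hν hi f hf
      rw [hPrev.sum_actD_mul, hQrev.sum_actD_mul] at hsd
      simp only [actF, mul_div_assoc', ← Finset.sum_div, div_mul_eq_mul_div] at hsd
      exact (div_le_div_iff_of_pos_right h0).1 hsd
  · intro h ν _ hν f hf
    have hg := h f _ hf hν
    rw [← hPrev.sum_actD_mul, ← hQrev.sum_actD_mul] at hg
    simpa only [div_mul_cancel₀ _ (hpos _).ne'] using hg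
end

section
/- Let V be a finite set, θ ∈ (0,1), and let μ be a monotone system on {0,1}^V with lifted distribution π on {0,1,⋆}^V. Then π is a monotone system: for every i ∈ V and all feasible pinnings σ, τ ∈ {0,1,⋆}^{V∖{i}} with σ ≼ τ (coordinatewise with 0 < 1 < ⋆), the conditional distribution π_i^σ of coordinate i given σ is stochastically dominated by π_i^τ, i.e., π_i^σ({1,⋆}) ≤ π_i^τ({1,⋆}) and π_i^σ({⋆}) ≤ π_i^τ({⋆}). -/
open Finset

attribute [local instance] Classical.propDecidable

/-- The contracting map `{0,1,⋆}^V → {0,1}^V` (with `⋆` encoded as `2 : Fin 3`),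
sending `0` to `0` and both `1` and `⋆` to `1`, coordinatewise. -/
def contr {V : Type*} (σ : V → Fin 3) : V → Bool :=
  fun v => if σ v = 0 then false else true

/-- The number of coordinates of `σ ∈ {0,1,⋆}^V` equal to `1`. -/
def C1 {V : Type*} [Fintype V] (σ : V → Fin 3) : ℕ :=
  (univ.filter (fun v => σ v = 1)).card

/-- The number of coordinates of `σ ∈ {0,1,⋆}^V` equal to `⋆` (encoded as `2`). -/
def Cstar {V : Type*} [Fintype V] (σ : V → Fin 3) : ℕ :=
  (univ.filter (fun v => σ v = 2)).card

/-- The single-coordinate lifting probabilities: `0 ↦ 0` with probability 1,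
`1 ↦ 1` with probability `θ` and `1 ↦ ⋆` with probability `1-θ`. -/
noncomputable def liftCoord (θ : ℝ) (b : Bool) (y : Fin 3) : ℝ :=
  if b = false ∧ y = 0 then 1
  else if b = true ∧ y = 1 then θ
  else if b = true ∧ y = 2 then 1 - θ
  else 0

/-- The lift kernel `L(X,Y) = ∏_v ℓ(X_v, Y_v)` from `{0,1}^V` to `{0,1,⋆}^V`. -/
noncomputable def liftKernel {V : Type*} [Fintype V] (θ : ℝ) (X : V → Bool)
    (Y : V → Fin 3) : ℝ :=
  ∏ v, liftCoord θ (X v) (Y v)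

/-- The lifted distribution `π` on `{0,1,⋆}^V` of a distribution `μ` on `{0,1}^V`:
`π(σ) = μ(contr σ) · θ^{C₁(σ)} · (1-θ)^{C_⋆(σ)}`. -/
noncomputable def liftedDist {V : Type*} [Fintype V] (μ : (V → Bool) → ℝ) (θ : ℝ) :
    (V → Fin 3) → ℝ :=
  fun σ => μ (contr σ) * θ ^ C1 σ * (1 - θ) ^ Cstar σ

/-- `μ` is a monotone system: conditional marginals at a site are monotone in the
(feasible) pinning of the remaining sites. -/
def MonotoneSystem {V : Type*} [Fintype V] [DecidableEq V] (μ : (V → Bool) → ℝ) : Prop :=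
  ∀ (i : V) (σ τ : V → Bool), (∀ v, v ≠ i → σ v ≤ τ v) →
    0 < μ (Function.update σ i false) + μ (Function.update σ i true) →
    0 < μ (Function.update τ i false) + μ (Function.update τ i true) →
    μ (Function.update σ i true) /
        (μ (Function.update σ i false) + μ (Function.update σ i true)) ≤
      μ (Function.update τ i true) /
        (μ (Function.update τ i false) + μ (Function.update τ i true))

/-- The conditional probability that coordinate `i` takes value `x` under `ν`, given the
pinning of the remaining coordinates determined by `σ`. -/
noncomputable def condProb {V : Type*} [Fintype V] [DecidableEq V] {S : Type*} [Fintype S]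
    (ν : (V → S) → ℝ) (σ : V → S) (i : V) (x : S) : ℝ :=
  ν (Function.update σ i x) / ∑ s : S, ν (Function.update σ i s)

/-- The weight `0 ↦ 1`, `1 ↦ θ`, `⋆ ↦ 1 - θ` of a single lifted coordinate. -/
noncomputable def liftWeight (θ : ℝ) (s : Fin 3) : ℝ :=
  (if s = 1 then θ else 1) * (if s = 2 then 1 - θ else 1)

lemma liftWeight_pos {θ : ℝ} (hθ : θ ∈ Set.Ioo (0 : ℝ) 1) (s : Fin 3) :
    0 < liftWeight θ s := by
  have h0 := hθ.1
  have h1 := sub_pos.2 hθ.2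
  unfold liftWeight
  split_ifs <;> positivity

lemma liftedDist_eq_prod {V : Type*} [Fintype V] (μ : (V → Bool) → ℝ) (θ : ℝ)
    (σ : V → Fin 3) : liftedDist μ θ σ = μ (contr σ) * ∏ v, liftWeight θ (σ v) := by
  simp only [liftedDist, liftWeight, C1, Cstar, prod_mul_distrib, mul_assoc,
    ← prod_filter, prod_const]

lemma contr_le_contr {V : Type*} {σ τ : V → Fin 3} {v : V} (h : σ v ≤ τ v) :
    contr σ v ≤ contr τ v := by
  unfold contr
  by_cases hτ : τ v = 0
  · have hσ : σ v = 0 := by simpa [hτ] using h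
    simp [hσ]
  · simp only [hτ, if_false]
    exact Bool.le_true _

lemma contr_update {V : Type*} [DecidableEq V] (σ : V → Fin 3) (i : V) (s : Fin 3) :
    contr (Function.update σ i s) =
      Function.update (contr σ) i (if s = 0 then false else true) := by
  ext v
  by_cases hv : v = i
  · subst hv; simp [contr]
  · simp [contr, hv]

/-- Up to a positive factor independent of the value at `i`, the lifted weight of a
configuration is the weight of its contraction times the lifting weight at `i`. -/
lemma liftedDist_update {V : Type*} [Fintype V] [DecidableEq V] (μ : (V → Bool) → ℝ)
    {θ : ℝ} (hθ : θ ∈ Set.Ioo (0 : ℝ) 1) (i : V) (σ : V → Fin 3) :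
    ∃ K : ℝ, 0 < K ∧ ∀ s, liftedDist μ θ (Function.update σ i s) =
      K * (μ (Function.update (contr σ) i (if s = 0 then false else true)) *
        liftWeight θ s) := by
  refine ⟨∏ v ∈ univ.erase i, liftWeight θ (σ v),
    prod_pos fun v _ => liftWeight_pos hθ _, fun s => ?_⟩
  have hprod : ∏ v ∈ univ.erase i, liftWeight θ (Function.update σ i s v) =
      ∏ v ∈ univ.erase i, liftWeight θ (σ v) :=
    prod_congr rfl fun v hv => by rw [Function.update_of_ne (ne_of_mem_erase hv)]
  rw [liftedDist_eq_prod, contr_update, ← mul_prod_erase univ _ (mem_univ i), hprod,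
    Function.update_self]
  ring

/-- A feasible lifted pinning contracts to a feasible pinning, and the conditional
marginal of the lifted distribution is the lift of the conditional marginal. -/
lemma condProb_liftedDist {V : Type*} [Fintype V] [DecidableEq V] (μ : (V → Bool) → ℝ)
    {θ : ℝ} (hθ : θ ∈ Set.Ioo (0 : ℝ) 1) (i : V) (σ : V → Fin 3)
    (hσ : 0 < ∑ s : Fin 3, liftedDist μ θ (Function.update σ i s)) :
    0 < μ (Function.update (contr σ) i false) + μ (Function.update (contr σ) i true) ∧
      ∀ s : Fin 3, s ≠ 0 → condProb (liftedDist μ θ) σ i s =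
        μ (Function.update (contr σ) i true) /
          (μ (Function.update (contr σ) i false) + μ (Function.update (contr σ) i true)) *
          liftWeight θ s := by
  obtain ⟨K, hK, h⟩ := liftedDist_update μ hθ i σ
  have hsum : ∑ s : Fin 3, liftedDist μ θ (Function.update σ i s) =
      K * (μ (Function.update (contr σ) i false) +
        μ (Function.update (contr σ) i true)) := by
    simp only [h, Fin.sum_univ_three]
    simp [liftWeight]
    ring
  rw [hsum] at hσ
  have hpos := pos_of_mul_pos_right hσ hK.le
  refine ⟨hpos, fun s hs => ?_⟩
  rw [condProb, hsum, h, if_neg hs, mul_div_mul_left _ _ hK.ne']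
  ring

/-- **The lifted distribution of a monotone system is a monotone system**: for every
site `i` and feasible pinnings `σ ≼ τ` off `i` (coordinatewise with `0 < 1 < ⋆`), the
conditional distribution `π_i^σ` is stochastically dominated by `π_i^τ`, i.e.
`π_i^σ({1,⋆}) ≤ π_i^τ({1,⋆})` and `π_i^σ({⋆}) ≤ π_i^τ({⋆})`. -/
theorem lifted_monotone {V : Type*} [Fintype V] [DecidableEq V]
    (μ : (V → Bool) → ℝ) (hμ : IsDist μ) (hmono : MonotoneSystem μ)
    (θ : ℝ) (hθ : θ ∈ Set.Ioo (0 : ℝ) 1)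
    (i : V) (σ τ : V → Fin 3) (hle : ∀ v, v ≠ i → σ v ≤ τ v)
    (hσ : 0 < ∑ s : Fin 3, liftedDist μ θ (Function.update σ i s))
    (hτ : 0 < ∑ s : Fin 3, liftedDist μ θ (Function.update τ i s)) :
    (condProb (liftedDist μ θ) σ i 1 + condProb (liftedDist μ θ) σ i 2 ≤
        condProb (liftedDist μ θ) τ i 1 + condProb (liftedDist μ θ) τ i 2) ∧
      condProb (liftedDist μ θ) σ i 2 ≤ condProb (liftedDist μ θ) τ i 2 := by
  obtain ⟨hσ', hcσ⟩ := condProb_liftedDist μ hθ i σ hσ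
  obtain ⟨hτ', hcτ⟩ := condProb_liftedDist μ hθ i τ hτ
  have key := hmono i (contr σ) (contr τ) (fun v hv => contr_le_contr (hle v hv)) hσ' hτ'
  rw [hcσ 1 (by decide), hcσ 2 (by decide), hcτ 1 (by decide), hcτ 2 (by decide)]
  have h1 := mul_le_mul_of_nonneg_right key (liftWeight_pos hθ 1).le
  have h2 := mul_le_mul_of_nonneg_right key (liftWeight_pos hθ 2).le
  exact ⟨add_le_add h1 h2, h2⟩
end
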